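/- arXiv:math/0412546 — 3 statements merged into one kernel-verified Lean document; each statement's English description precedes it below -/
import Mathlib

section
/- Let p be a probability mass function on ℕ (p(n) ≥ 0, ∑ p(n) = 1) and suppose the function g(s) = ∑_{n=0}^∞ p(n) · (1-s)^n is absolutely convergent for every s > 0, is infinitely differentiable on (0,∞), and is completely monotone, i.e. (-1)^k · (iteratedDeriv k g) s ≥ 0 for every s > 0 and every k ∈ ℕ. Then there exists a probability measure μ on ℝ supported on [0,∞) such that ∫ e^{-s·x} dμ(x) = g(s) for all s > 0; that is, φ(s) = P(1-s) is a Laplace transform, where P is the PGF of p. -/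
open MeasureTheory Set

open Filter Topology unitInterval

/-- A function that is the sum of a power series around `1` converging absolutely at every positive
real is analytic with infinite radius of convergence. -/
theorem hasFPowerSeriesOnBall_top_of_tsum_one_sub {p : ℕ → ℝ} {g : ℝ → ℝ}
    (hg : ∀ s : ℝ, g s = ∑' n : ℕ, p n * (1 - s) ^ n)
    (hg_abs : ∀ s : ℝ, 0 < s → Summable (fun n : ℕ => |p n * (1 - s) ^ n|)) :
    HasFPowerSeriesOnBall g
      (FormalMultilinearSeries.ofScalars ℝ fun n => p n * (-1) ^ n) 1 ⊤ := by
  have hnorm (r : ℝ) (hr : 0 ≤ r) : Summable fun n : ℕ => |p n| * r ^ n := by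
    refine (hg_abs (1 + r) (by linarith)).congr fun n => ?_
    simp [abs_mul, abs_pow, abs_of_nonneg hr]
  refine ⟨?_, by simp, fun {y} _ => ?_⟩
  · rw [FormalMultilinearSeries.radius_eq_top_of_summable_norm]
    intro r
    simpa [FormalMultilinearSeries.ofScalars_norm, abs_mul] using hnorm r r.2
  · have hs : Summable fun n : ℕ => p n * (1 - (1 + y)) ^ n := by
      refine Summable.of_norm ((hnorm |y| (abs_nonneg y)).congr fun n => ?_)
      simp
    rw [hg]
    convert! hs.hasSum using 2 with n
    rw [FormalMultilinearSeries.ofScalars_apply_eq, smul_eq_mul, mul_assoc, ← mul_pow]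
    congr 2
    ring

/-- An analytic function with infinite radius of convergence is the sum of its Taylor series
around every point. -/
theorem HasFPowerSeriesOnBall.hasSum_iteratedDeriv_of_top {g : ℝ → ℝ}
    {q : FormalMultilinearSeries ℝ ℝ ℝ} {x : ℝ} (h : HasFPowerSeriesOnBall g q x ⊤) (c y : ℝ) :
    HasSum (fun n : ℕ => (n.factorial : ℝ)⁻¹ * (y ^ n * iteratedDeriv n g c)) (g (c + y)) := by
  have hc := h.changeOrigin (y := c - x) (by simp)
  rw [add_sub_cancel, ENNReal.top_sub (by simp)] at hc
  convert! hc.hasSum_iteratedFDeriv (y := y) (by simp) using 2 with n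
  rw [iteratedFDeriv_apply_eq_iteratedDeriv_mul_prod]
  simp

/-- The discrete probability measure with weights `w` at the points `y`. -/
theorem exists_probabilityMeasure_hasSum {α : Type*} [TopologicalSpace α] [CompactSpace α]
    [MeasurableSpace α] [BorelSpace α] [MeasurableSingletonClass α] {w : ℕ → ℝ}
    (hw : ∀ n, 0 ≤ w n) (hw1 : HasSum w 1) (y : ℕ → α) :
    ∃ ν : ProbabilityMeasure α, ∀ f : C(α, ℝ),
      HasSum (fun n => w n * f (y n)) (∫ x, f x ∂(ν : Measure α)) := by
  let ν : Measure α := Measure.sum fun n => ENNReal.ofReal (w n) • Measure.dirac (y n)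
  have hν : IsProbabilityMeasure ν := by
    refine ⟨?_⟩
    simp [ν, ← ENNReal.ofReal_tsum_of_nonneg hw hw1.summable, hw1.tsum_eq]
  refine ⟨⟨ν, hν⟩, fun f => ?_⟩
  have hf : Integrable f ν := f.continuous.integrable_of_hasCompactSupport
    (HasCompactSupport.of_compactSpace _)
  convert! hasSum_integral_measure hf using 2 with n
  simp [integral_smul_measure, hw n]

/-- Convergence of the moments of all positive real orders of probability measures on the unit
interval to a function with limit `1` at `0` makes that function a Laplace transform. -/
theorem exists_laplace_eq_of_tendsto_integral_rpow {F : ℝ → ℝ} (ν : ℕ → ProbabilityMeasure I)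
    (hν : ∀ s : ℝ, 0 < s →
      Tendsto (fun n => ∫ y : I, (y : ℝ) ^ s ∂(ν n : Measure I)) atTop (𝓝 (F s)))
    (hF : Tendsto F (𝓝[>] 0) (𝓝 1)) :
    ∃ μ : Measure ℝ, IsProbabilityMeasure μ ∧ μ (Iio 0) = 0 ∧
      ∀ s : ℝ, 0 < s → (∫ x, Real.exp (-(s * x)) ∂μ) = F s := by
  let U : Ultrafilter ℕ := hyperfilter ℕ
  obtain ⟨m, -, hm⟩ := isCompact_univ.ultrafilter_le_nhds (U.map ν) (by simp)
  have hm' : Tendsto ν U (𝓝 m) := hm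
  rw [ProbabilityMeasure.tendsto_iff_forall_integral_tendsto] at hm'
  have hcont (s : ℝ) (hs : 0 < s) : Continuous fun y : I => (y : ℝ) ^ s :=
    continuous_subtype_val.rpow_const fun _ => Or.inr hs.le
  have hmom (s : ℝ) (hs : 0 < s) : ∫ y : I, (y : ℝ) ^ s ∂(m : Measure I) = F s :=
    tendsto_nhds_unique
      (hm' (BoundedContinuousFunction.mkOfCompact ⟨fun y : I => (y : ℝ) ^ s, hcont s hs⟩))
      ((hν s hs).mono_left Nat.hyperfilter_le_atTop)
  have hzero : (m : Measure I).real {0} = 0 := by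
    have hle : ∀ᶠ s in 𝓝[>] (0 : ℝ), F s ≤ (m : Measure I).real {0}ᶜ := by
      filter_upwards [self_mem_nhdsWithin] with s hs
      have hs' : 0 < s := hs
      rw [← hmom s hs', ← integral_indicator_one (measurableSet_singleton _).compl]
      refine integral_mono
        ((hcont s hs').integrable_of_hasCompactSupport (HasCompactSupport.of_compactSpace _))
        ((integrable_const _).indicator (measurableSet_singleton _).compl) fun y => ?_
      by_cases hy : y = 0
      · simp [hy, Real.zero_rpow hs'.ne']
      · simpa [hy] using Real.rpow_le_one y.2.1 y.2.2 hs'.le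
    have h1 := le_of_tendsto hF hle
    rw [probReal_compl_eq_one_sub (measurableSet_singleton _)] at h1
    exact le_antisymm (by linarith) measureReal_nonneg
  have hae : ∀ᵐ y : I ∂(m : Measure I), y ≠ 0 := by
    rw [ae_iff]
    simpa [measureReal_eq_zero_iff] using hzero
  have hlog : Measurable fun y : I => -Real.log y :=
    (Real.measurable_log.comp measurable_subtype_coe).neg
  refine ⟨(m : Measure I).map fun y : I => -Real.log y,
    Measure.isProbabilityMeasure_map hlog.aemeasurable, ?_, fun s hs => ?_⟩
  · rw [Measure.map_apply hlog measurableSet_Iio]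
    convert measure_empty (μ := (m : Measure I))
    ext y
    simpa using Real.log_nonpos y.2.1 y.2.2
  · rw [integral_map hlog.aemeasurable (by fun_prop), ← hmom s hs]
    refine integral_congr_ae ?_
    filter_upwards [hae] with y hy
    rw [Real.rpow_def_of_pos (unitInterval.pos_iff_ne_zero.mpr hy)]
    ring_nf

theorem tendsto_mul_one_sub_exp_neg_div (s : ℝ) :
    Tendsto (fun n : ℕ => ((n : ℝ) + 1) * (1 - Real.exp (-s / (n + 1)))) atTop (𝓝 s) := by
  have hd : HasDerivAt (fun t : ℝ => 1 - Real.exp (-s * t)) s 0 := by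
    convert! (((hasDerivAt_id (0 : ℝ)).const_mul (-s)).exp).const_sub 1 using 1
    simp
  have ht : Tendsto (fun n : ℕ => ((n : ℝ) + 1)⁻¹) atTop (𝓝[>] 0) :=
    tendsto_nhdsWithin_iff.mpr
      ⟨by simpa using tendsto_one_div_add_atTop_nhds_zero_nat (𝕜 := ℝ),
        Eventually.of_forall fun n => by simp only [mem_Ioi]; positivity⟩
  refine (hd.tendsto_slope_zero_right.comp ht).congr fun n => ?_
  simp [div_eq_mul_inv]

/-- If `p` is a probability mass function on `ℕ` such that `g(s) = ∑ p(n)·(1-s)^n` is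
(absolutely convergent, smooth and) completely monotone on `(0,∞)`, then `g = φ` is the
Laplace transform of a probability measure `μ` on `[0,∞)`; that is, `φ(s) = P(1-s)` is a
Laplace transform, where `P` is the PGF of `p`. -/
theorem pgf_oneSub_isLaplaceTransform
    (p : ℕ → ℝ) (hp_nonneg : ∀ n : ℕ, 0 ≤ p n) (hp_sum : (∑' n : ℕ, p n) = 1)
    (g : ℝ → ℝ) (hg : ∀ s : ℝ, g s = ∑' n : ℕ, p n * (1 - s) ^ n)
    (hg_abs : ∀ s : ℝ, 0 < s → Summable (fun n : ℕ => |p n * (1 - s) ^ n|))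
    (hg_smooth : ContDiffOn ℝ (⊤ : ℕ∞) g (Ioi 0))
    (hg_cm : ∀ s : ℝ, 0 < s → ∀ k : ℕ, 0 ≤ (-1 : ℝ) ^ k * iteratedDeriv k g s) :
    ∃ μ : Measure ℝ, IsProbabilityMeasure μ ∧ μ (Iio 0) = 0 ∧
      ∀ s : ℝ, 0 < s → (∫ x, Real.exp (-(s * x)) ∂μ) = g s := by
  have hpow := hasFPowerSeriesOnBall_top_of_tsum_one_sub hg hg_abs
  have hcont : Continuous g := by
    simpa [← continuousOn_univ] using hpow.continuousOn
  have hg0 : g 0 = 1 := by simp [hg, hp_sum]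
  let w (n k : ℕ) : ℝ :=
    (k.factorial : ℝ)⁻¹ * ((-((n : ℝ) + 1)) ^ k * iteratedDeriv k g (n + 1))
  have hw (n k : ℕ) : 0 ≤ w n k := by
    have h := hg_cm (n + 1) (by positivity) k
    have : w n k = (k.factorial : ℝ)⁻¹ * ((n : ℝ) + 1) ^ k *
        ((-1) ^ k * iteratedDeriv k g (n + 1)) := by
      simp only [w]
      rw [neg_pow]
      ring
    rw [this]
    positivity
  have hsum (n : ℕ) (u : ℝ) : HasSum (fun k => w n k * u ^ k) (g ((n + 1) * (1 - u))) := by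
    convert hpow.hasSum_iteratedDeriv_of_top (n + 1) (-(n + 1) * u) using 2 with k
    · simp only [w, mul_pow]
      ring
    · ring
  have hw1 (n : ℕ) : HasSum (w n) 1 := by simpa [hg0] using hsum n 1
  have hpoint (n k : ℕ) : Real.exp (-(k : ℝ) / (n + 1)) ∈ I :=
    ⟨(Real.exp_pos _).le, Real.exp_le_one_iff.mpr
      (div_nonpos_of_nonpos_of_nonneg (by simp) (by positivity))⟩
  choose ν hν using fun n =>
    exists_probabilityMeasure_hasSum (hw n) (hw1 n) fun k => (⟨_, hpoint n k⟩ : I)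
  refine exists_laplace_eq_of_tendsto_integral_rpow ν (fun s hs => ?_) ?_
  · refine ((hcont.tendsto s).comp (tendsto_mul_one_sub_exp_neg_div s)).congr fun n => ?_
    refine HasSum.unique (hsum n _) ?_
    convert! hν n ⟨fun y : I => (y : ℝ) ^ s,
      continuous_subtype_val.rpow_const fun _ => Or.inr hs.le⟩ using 3 with k
    simp only [ContinuousMap.coe_mk]
    rw [← Real.exp_mul, ← Real.exp_nat_mul]
    ring_nf
  · simpa [hg0] using (hcont.tendsto 0).mono_left nhdsWithin_le_nhds
end

section
/- Let μ be a probability measure on ℝ supported on [0,∞) and let c ∈ (0,1). Suppose μ is semi-selfdecomposable with span c in the Laplace-transform sense: there exists a probability measure ν supported on [0,∞) such that ∫ e^{-s·x} dμ(x) = (∫ e^{-c·s·x} dμ(x)) · (∫ e^{-s·x} dν(x)) for all s ≥ 0. Define p(n) = ∫ exp(-x) · x^n / n! dμ(x) for n ∈ ℕ. Then p is a probability mass function on ℕ that is discrete semi-selfdecomposable with span c: there exists a probability mass function q on ℕ such that for all s ∈ [0,1], ∑_{n} p(n) s^n = (∑_{n} p(n) (1 - c + c·s)^n) · (∑_{n}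 q(n) s^n). -/
open MeasureTheory Set

/-- The weights of the mixed Poisson distribution directed by `μ`. -/
noncomputable def mixedPoissonWeight (μ : Measure ℝ) (n : ℕ) : ℝ :=
  ∫ x, Real.exp (-x) * x ^ n / n.factorial ∂μ

lemma ae_nonneg_of_measure_Iio_eq_zero {μ : Measure ℝ} (hμ : μ (Iio 0) = 0) :
    ∀ᵐ x ∂μ, 0 ≤ x := by
  simp only [ae_iff, not_le]
  exact hμ

lemma mixedPoissonWeight_nonneg {μ : Measure ℝ} (hμ : μ (Iio 0) = 0) (n : ℕ) :
    0 ≤ mixedPoissonWeight μ n := by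
  refine integral_nonneg_of_ae ?_
  filter_upwards [ae_nonneg_of_measure_Iio_eq_zero hμ] with x hx
  dsimp only [Pi.zero_apply]
  positivity

lemma hasSum_exp_neg_mul_pow_div_factorial (x s : ℝ) :
    HasSum (fun n : ℕ => Real.exp (-x) * x ^ n / n.factorial * s ^ n)
      (Real.exp (-((1 - s) * x))) := by
  have h := (NormedSpace.expSeries_div_hasSum_exp (s * x)).mul_left (Real.exp (-x))
  rw [← Real.exp_eq_exp_ℝ, ← Real.exp_add] at h
  have hterm : (fun n : ℕ => Real.exp (-x) * x ^ n / n.factorial * s ^ n) =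
      fun n : ℕ => Real.exp (-x) * ((s * x) ^ n / n.factorial) := by
    funext n
    rw [mul_pow]
    ring
  rw [hterm, show -((1 - s) * x) = -x + s * x by ring]
  exact h

/-- The generating function of the mixed Poisson distribution directed by `μ` is the Laplace
transform of `μ` at `1 - s`. -/
lemma hasSum_mixedPoissonWeight_mul_pow {μ : Measure ℝ} [IsFiniteMeasure μ]
    (hμ : μ (Iio 0) = 0) {s : ℝ} (hs : s ∈ Icc (0 : ℝ) 1) :
    HasSum (fun n => mixedPoissonWeight μ n * s ^ n)
      (∫ x, Real.exp (-((1 - s) * x)) ∂μ) := by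
  have hnonneg := ae_nonneg_of_measure_Iio_eq_zero hμ
  have hone : ∀ x : ℝ, HasSum (fun n : ℕ => Real.exp (-x) * x ^ n / n.factorial) 1 := fun x => by
    simpa using hasSum_exp_neg_mul_pow_div_factorial x 1
  simp only [mixedPoissonWeight, ← integral_mul_const]
  refine hasSum_integral_of_dominated_convergence
    (fun n x => Real.exp (-x) * x ^ n / n.factorial) (fun n => ?_) (fun n => ?_)
    (.of_forall fun x => (hone x).summable) ?_
    (.of_forall fun x => hasSum_exp_neg_mul_pow_div_factorial x s)
  · exact Continuous.aestronglyMeasurable (by fun_prop)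
  · filter_upwards [hnonneg] with x hx
    have hs0 := hs.1
    rw [Real.norm_of_nonneg (by positivity)]
    exact mul_le_of_le_one_right (by positivity) (pow_le_one₀ hs.1 hs.2)
  · simp only [fun x => (hone x).tsum_eq]
    exact integrable_const 1

lemma tsum_mixedPoissonWeight {μ : Measure ℝ} [IsProbabilityMeasure μ] (hμ : μ (Iio 0) = 0) :
    ∑' n, mixedPoissonWeight μ n = 1 := by
  simpa using (hasSum_mixedPoissonWeight_mul_pow hμ (right_mem_Icc.2 zero_le_one)).tsum_eq

/-- If a Laplace transform `φ` of a probability measure `μ` on `[0,∞)` is semi-SD(c), then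
the probability generating function `P(s) = φ(1-s)` is discrete semi-SD(c): the mixed Poisson
PMF `p n = ∫ e^{-x} x^n/n! dμ(x)` satisfies `P(s) = P(1-c+c·s)·Q(s)` for the PGF `Q` of some
PMF `q` on `ℕ`. -/
theorem discrete_semiSelfdecomposable_of_semiSelfdecomposable_LT
    (μ : Measure ℝ) [IsProbabilityMeasure μ] (hμ_supp : μ (Iio 0) = 0)
    (c : ℝ) (hc : c ∈ Ioo (0 : ℝ) 1)
    (hssd : ∃ ν : Measure ℝ, IsProbabilityMeasure ν ∧ ν (Iio 0) = 0 ∧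
      ∀ s : ℝ, 0 ≤ s →
        (∫ x, Real.exp (-(s * x)) ∂μ) =
          (∫ x, Real.exp (-(c * s * x)) ∂μ) * ∫ x, Real.exp (-(s * x)) ∂ν)
    (p : ℕ → ℝ) (hp : ∀ n : ℕ, p n = ∫ x, Real.exp (-x) * x ^ n / n.factorial ∂μ) :
    (∀ n : ℕ, 0 ≤ p n) ∧ (∑' n : ℕ, p n) = 1 ∧
      ∃ q : ℕ → ℝ, (∀ n : ℕ, 0 ≤ q n) ∧ (∑' n : ℕ, q n) = 1 ∧
        ∀ s ∈ Icc (0 : ℝ) 1,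
          (∑' n : ℕ, p n * s ^ n) =
            (∑' n : ℕ, p n * (1 - c + c * s) ^ n) * ∑' n : ℕ, q n * s ^ n := by
  obtain rfl : p = mixedPoissonWeight μ := funext hp
  obtain ⟨ν, _, hν_supp, hfactor⟩ := hssd
  refine ⟨mixedPoissonWeight_nonneg hμ_supp, tsum_mixedPoissonWeight hμ_supp,
    mixedPoissonWeight ν, mixedPoissonWeight_nonneg hν_supp, tsum_mixedPoissonWeight hν_supp,
    fun s hs => ?_⟩
  have hcs : 1 - c + c * s ∈ Icc (0 : ℝ) 1 :=
    ⟨by nlinarith [hc.1, hc.2, hs.1], by nlinarith [hc.1, hs.2]⟩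
  rw [(hasSum_mixedPoissonWeight_mul_pow hμ_supp hs).tsum_eq,
    (hasSum_mixedPoissonWeight_mul_pow hμ_supp hcs).tsum_eq,
    (hasSum_mixedPoissonWeight_mul_pow hν_supp hs).tsum_eq, hfactor (1 - s) (by linarith [hs.2])]
  congr! 6
  ring
end

section
/- Let (p_t)_{t>0} be a family of probability mass functions on ℕ whose probability generating functions P_t(s) = ∑_n p_t(n) s^n are multiplicative in t: P_{t+u}(s) = P_t(s) · P_u(s) for all t, u > 0 and all s ∈ [0,1]. Suppose for some 0 < b < 1 < a the discrete semi-stability relation P_1(s) = P_a(1 - b + b·s) holds for all s ∈ [0,1] (i.e. P_1 is infinitely divisible and P_1(s) = P_1(1-b+b·s)^a). Then p_1 is discrete semi-selfdecomposable with span b: there exists a probability mass function r on ℕ such that P_1(s) = P_1(1 - b + b·s) · (∑_n r(n) s^n) for all s ∈ [0,1]. -/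
open Set

/-- The binomial thinning with parameter `b` of a sequence `q` of weights on `ℕ`. -/
noncomputable def binomialThinning (b : ℝ) (q : ℕ → ℝ) (k : ℕ) : ℝ :=
  ∑' n : ℕ, q n * ((n.choose k : ℝ) * b ^ k * (1 - b) ^ (n - k))

theorem binomialThinning_nonneg {b : ℝ} (hb : 0 ≤ b) (hb1 : b ≤ 1) {q : ℕ → ℝ}
    (hq : ∀ n, 0 ≤ q n) (k : ℕ) : 0 ≤ binomialThinning b q k := by
  have hc : 0 ≤ 1 - b := sub_nonneg.2 hb1
  exact tsum_nonneg fun n => mul_nonneg (hq n) (by positivity)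

theorem hasSum_binomial_mul_pow (b s : ℝ) (n : ℕ) :
    HasSum (fun k : ℕ => (n.choose k : ℝ) * b ^ k * (1 - b) ^ (n - k) * s ^ k)
      ((1 - b + b * s) ^ n) := by
  have h : (1 - b + b * s) ^ n = ∑ k ∈ Finset.range (n + 1),
      (n.choose k : ℝ) * b ^ k * (1 - b) ^ (n - k) * s ^ k := by
    rw [add_comm, add_pow]
    refine Finset.sum_congr rfl fun k _ => ?_
    rw [mul_pow]
    ring
  rw [h]
  refine hasSum_sum_of_ne_finset_zero fun k hk => ?_
  have hnk : n < k := by simpa using hk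
  simp [Nat.choose_eq_zero_of_lt hnk]

/-- The generating function of a binomial thinning is the composition of the original generating
function with that of the Bernoulli law. -/
theorem tsum_binomialThinning_mul_pow {b : ℝ} (hb : 0 ≤ b) (hb1 : b ≤ 1) {q : ℕ → ℝ}
    (hq : ∀ n, 0 ≤ q n) (hq_summable : Summable q) {s : ℝ} (hs : s ∈ Icc (0 : ℝ) 1) :
    ∑' k : ℕ, binomialThinning b q k * s ^ k = ∑' n : ℕ, q n * (1 - b + b * s) ^ n := by
  have hc : 0 ≤ 1 - b := sub_nonneg.2 hb1
  have hs0 : 0 ≤ s := hs.1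
  have hφ0 : 0 ≤ 1 - b + b * s := by positivity
  have hφ1 : 1 - b + b * s ≤ 1 := by nlinarith [hs.2]
  let f : ℕ → ℕ → ℝ := fun n k => q n * ((n.choose k : ℝ) * b ^ k * (1 - b) ^ (n - k) * s ^ k)
  have hf : ∀ n, HasSum (f n) (q n * (1 - b + b * s) ^ n) := fun n =>
    (hasSum_binomial_mul_pow b s n).mul_left (q n)
  have hf_nonneg : 0 ≤ Function.uncurry f := fun x =>
    mul_nonneg (hq x.1) (by positivity)
  have hf_summable : Summable (Function.uncurry f) := by
    refine (summable_prod_of_nonneg hf_nonneg).2 ⟨fun n => (hf n).summable, ?_⟩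
    refine Summable.of_nonneg_of_le (fun n => tsum_nonneg fun k => hf_nonneg (n, k))
      (fun n => ?_) hq_summable
    exact (hf n).tsum_eq.trans_le (mul_le_of_le_one_right (hq n) (pow_le_one₀ hφ0 hφ1))
  calc ∑' k : ℕ, binomialThinning b q k * s ^ k = ∑' k : ℕ, ∑' n : ℕ, f n k := by
        refine tsum_congr fun k => ?_
        rw [binomialThinning, ← tsum_mul_right]
        exact tsum_congr fun n => mul_assoc _ _ _
    _ = ∑' n : ℕ, ∑' k : ℕ, f n k := hf_summable.tsum_comm
    _ = ∑' n : ℕ, q n * (1 - b + b * s) ^ n := tsum_congr fun n => (hf n).tsum_eq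

/-- Discrete semi-stable(a,b) laws are discrete semi-SD(b): if `(p t)` is a family of PMFs on
`ℕ` whose PGFs are multiplicative in `t` and `P 1 (s) = P a (1-b+b·s)` for some
`0 < b < 1 < a`, then `p 1` is discrete semi-selfdecomposable with span `b`. -/
theorem discrete_semiStable_discrete_semiSelfdecomposable
    (a b : ℝ) (hb : 0 < b) (hb1 : b < 1) (ha : 1 < a)
    (p : ℝ → ℕ → ℝ)
    (hp_nonneg : ∀ t : ℝ, 0 < t → ∀ n : ℕ, 0 ≤ p t n)
    (hp_sum : ∀ t : ℝ, 0 < t → (∑' n : ℕ, p t n) = 1)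
    (hp_mul : ∀ t : ℝ, 0 < t → ∀ u : ℝ, 0 < u → ∀ s ∈ Icc (0 : ℝ) 1,
      (∑' n : ℕ, p (t + u) n * s ^ n) =
        (∑' n : ℕ, p t n * s ^ n) * ∑' n : ℕ, p u n * s ^ n)
    (hp_semistable : ∀ s ∈ Icc (0 : ℝ) 1,
      (∑' n : ℕ, p 1 n * s ^ n) = ∑' n : ℕ, p a n * (1 - b + b * s) ^ n) :
    ∃ r : ℕ → ℝ, (∀ n : ℕ, 0 ≤ r n) ∧ (∑' n : ℕ, r n) = 1 ∧
      ∀ s ∈ Icc (0 : ℝ) 1,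
        (∑' n : ℕ, p 1 n * s ^ n) =
          (∑' n : ℕ, p 1 n * (1 - b + b * s) ^ n) * ∑' n : ℕ, r n * s ^ n := by
  have ha' : 0 < a - 1 := sub_pos.2 ha
  have hq := hp_nonneg (a - 1) ha'
  have hq_summable : Summable (p (a - 1)) :=
    by_contra fun h => by simpa [tsum_eq_zero_of_not_summable h] using hp_sum (a - 1) ha'
  refine ⟨binomialThinning b (p (a - 1)), binomialThinning_nonneg hb.le hb1.le hq, ?_, ?_⟩
  · simpa [hp_sum (a - 1) ha'] using
      tsum_binomialThinning_mul_pow hb.le hb1.le hq hq_summable (right_mem_Icc.2 zero_le_one)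
  · intro s hs
    have hφ : 1 - b + b * s ∈ Icc (0 : ℝ) 1 :=
      ⟨by nlinarith [hs.1], by nlinarith [hs.2]⟩
    rw [hp_semistable s hs, tsum_binomialThinning_mul_pow hb.le hb1.le hq hq_summable hs,
      ← hp_mul 1 one_pos (a - 1) ha' _ hφ, add_sub_cancel]
end
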